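/- Let m and k be integers with m ≥ 6 and 5 ≤ k ≤ m. Then c_m^F(−1, m−k) ≤ (3 + 2·10^{−5} + (13/(44π))·k^{1/2})·ĉ_m^F(−1, m−k), where c_m^F(−1, ℓ̃) = Σ_{r≥1} (2r + ℓ̃)·d(m − r² − rℓ̃) for 0 ≤ ℓ̃ ≤ m (a finite sum, since d vanishes below −1), and ĉ_m^F(−1, ℓ̃) = (ℓ̃ + 2)·d(m − 1 − ℓ̃). -/

import Mathlib

/-- `d n`: the coefficient of `q^(n+1)` in `∏ (1 - q^j)^{-24}`, i.e. the number of
24-tuples of integer partitions whose sizes sum to `n+1` (and `0` for `n < -1`). -/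
def dcoef (n : ℤ) : ℤ :=
  if 0 ≤ n + 1 then
    ∑ v ∈ Finset.Nat.antidiagonalTuple 24 (n + 1).toNat,
      ∏ i, (Fintype.card (Nat.Partition (v i)) : ℤ)
  else 0

/-- `c_m^F(−1, ℓ̃) = Σ_{r ≥ 1} (2r + ℓ̃) · d(m − r² − rℓ̃)`, a finite sum since
`d` vanishes below `−1`. -/
noncomputable def cFm1 (m ℓt : ℤ) : ℤ :=
  ∑ᶠ r : ℤ, if 1 ≤ r then (2 * r + ℓt) * dcoef (m - r ^ 2 - r * ℓt) else 0

open PowerSeries Finset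

/-- Adding `t` copies of `d` embeds the partitions of `n - t * d` into the partitions of `n`
having at least `t` parts equal to `d`. -/
lemma card_partition_le_card_count {n d t : ℕ} (hd : 0 < d) (h : t * d ≤ n) :
    Fintype.card (n - t * d).Partition ≤
      #{l : n.Partition | t ≤ l.parts.count d} := by
  rw [← Finset.card_univ]
  refine Finset.card_le_card_of_injOn
    (fun l ↦ ⟨l.parts + Multiset.replicate t d, ?_, ?_⟩) ?_ ?_
  · intro i hi
    rcases Multiset.mem_add.1 hi with hi | hi
    · exact l.parts_pos hi
    · rw [Multiset.eq_of_mem_replicate hi]; exact hd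
  · rw [Multiset.sum_add, l.parts_sum, Multiset.sum_replicate, smul_eq_mul]
    omega
  · intro l _
    simp
  · intro l _ l' _ hll
    have := congrArg Nat.Partition.parts hll
    exact Nat.Partition.ext (add_right_cancel this)

lemma card_partition_le_succ (n : ℕ) :
    Fintype.card n.Partition ≤ Fintype.card (n + 1).Partition := by
  have := card_partition_le_card_count (n := n + 1) (d := 1) (t := 1) one_pos (by omega)
  exact this.trans (Finset.card_le_univ _)

lemma Nat.Partition.sum_range_mul_count {n : ℕ} (l : n.Partition) :
    ∑ d ∈ range (n + 1), d * l.parts.count d = n := by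
  conv_rhs => rw [← l.parts_sum]
  rw [Finset.sum_multiset_count_of_subset l.parts (range (n + 1))]
  · exact Finset.sum_congr rfl fun d _ ↦ by rw [smul_eq_mul, mul_comm]
  · intro d hd
    have := Nat.Partition.le_of_mem_parts (Multiset.mem_toFinset.1 hd)
    simp only [mem_range]
    omega

/-- A lower bound for the sum-of-divisors function: the contribution of the divisors
`j` and `j / 2`. -/
def divisorWeight (j : ℕ) : ℕ := j + if Even j then j / 2 else 0

lemma sum_range_divisorWeight_mul_card_partition_le (n : ℕ) :
    ∑ j ∈ range (n + 1), divisorWeight j * Fintype.card (n - j).Partition ≤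
      n * Fintype.card n.Partition := by
  obtain ⟨N, hN⟩ : ∃ N : ℕ → ℕ → ℕ, ∀ t d, N t d = #{l : n.Partition | t ≤ l.parts.count d} :=
    ⟨_, fun _ _ ↦ rfl⟩
  have key (t d : ℕ) (h : t * d ≤ n) : d * Fintype.card (n - t * d).Partition ≤ d * N t d := by
    rcases d.eq_zero_or_pos with rfl | hd
    · simp
    · rw [hN]
      exact Nat.mul_le_mul_left _ (card_partition_le_card_count hd h)
  have h1 : ∑ j ∈ range (n + 1), j * Fintype.card (n - j).Partition ≤
      ∑ d ∈ range (n + 1), d * N 1 d :=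
    Finset.sum_le_sum fun d hd ↦ by
      have := key 1 d (by simp only [mem_range] at hd; omega)
      rwa [one_mul] at this
  have h2 : ∑ j ∈ range (n + 1), (if Even j then j / 2 else 0) * Fintype.card (n - j).Partition ≤
      ∑ d ∈ range (n + 1), d * N 2 d := by
    simp only [ite_mul, zero_mul]
    rw [← Finset.sum_filter]
    have hinj : Set.InjOn (fun j : ℕ ↦ j / 2) ({j ∈ range (n + 1) | Even j} : Finset ℕ) := by
      intro a ha b hb hab
      simp only [coe_filter, Set.mem_ofPred_eq, even_iff_two_dvd] at ha hb hab
      omega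
    calc _ ≤ ∑ j ∈ range (n + 1) with Even j, j / 2 * N 2 (j / 2) := by
          refine Finset.sum_le_sum fun j hj ↦ ?_
          simp only [mem_filter, mem_range, even_iff_two_dvd] at hj
          have h := key 2 (j / 2) (by omega)
          rwa [Nat.mul_div_cancel' hj.2] at h
      _ = ∑ d ∈ {j ∈ range (n + 1) | Even j}.image (fun j ↦ j / 2), d * N 2 d :=
          (Finset.sum_image (f := fun d ↦ d * N 2 d) hinj).symm
      _ ≤ _ := by
          refine Finset.sum_le_sum_of_subset fun d hd ↦ ?_
          simp only [mem_image, mem_filter, mem_range] at hd ⊢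
          omega
  calc _ ≤ ∑ d ∈ range (n + 1), d * (N 1 d + N 2 d) := by
        simp only [divisorWeight, add_mul, mul_add, Finset.sum_add_distrib]
        exact add_le_add h1 h2
    _ ≤ ∑ d ∈ range (n + 1), d * ∑ l : n.Partition, l.parts.count d := by
        refine Finset.sum_le_sum fun d _ ↦ Nat.mul_le_mul_left _ ?_
        simp only [hN, Finset.card_filter, ← Finset.sum_add_distrib]
        refine Finset.sum_le_sum fun l _ ↦ ?_
        split_ifs <;> omega
    _ = ∑ l : n.Partition, ∑ d ∈ range (n + 1), d * l.parts.count d := by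
        simp only [Finset.mul_sum]
        exact Finset.sum_comm
    _ = n * Fintype.card n.Partition := by
        simp [Nat.Partition.sum_range_mul_count, mul_comm]

/-- The power series has nonnegative coefficients. -/
def CoeffNonneg (f : ℝ⟦X⟧) : Prop := ∀ n, 0 ≤ coeff n f

namespace CoeffNonneg

lemma mul {f g : ℝ⟦X⟧} (hf : CoeffNonneg f) (hg : CoeffNonneg g) : CoeffNonneg (f * g) := by
  intro n
  rw [coeff_mul]
  exact Finset.sum_nonneg fun x _ ↦ mul_nonneg (hf _) (hg _)

lemma pow {f : ℝ⟦X⟧} (hf : CoeffNonneg f) (k : ℕ) : CoeffNonneg (f ^ k) := by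
  induction k with
  | zero =>
    intro n
    rw [pow_zero, coeff_one]
    split_ifs <;> norm_num
  | succ k ih => rw [pow_succ]; exact ih.mul hf

lemma mk {f : ℕ → ℝ} (hf : ∀ n, 0 ≤ f n) : CoeffNonneg (mk f) := fun n ↦ by
  rw [coeff_mk]; exact hf n

end CoeffNonneg

/-- The geometric series `1 / (1 - X)`. -/
noncomputable def geom : ℝ⟦X⟧ := mk 1

lemma geom_mul_one_sub : geom * (1 - X) = 1 := mk_one_mul_one_sub_eq_one ℝ

lemma coeffNonneg_geom : CoeffNonneg geom := .mk fun _ ↦ zero_le_one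

lemma coeff_geom_pow_succ (d n : ℕ) : coeff n (geom ^ (d + 1)) = ((d + n).choose d : ℝ) := by
  rw [geom, mk_one_pow_eq_mk_choose_add, coeff_mk]

/-- The generating function of the partition numbers. -/
noncomputable def partGF : ℝ⟦X⟧ := mk fun n ↦ (Fintype.card n.Partition : ℝ)

lemma coeffNonneg_partGF : CoeffNonneg partGF := .mk fun _ ↦ Nat.cast_nonneg _

lemma coeffNonneg_partGF_mul_one_sub : CoeffNonneg (partGF * (1 - X)) := by
  intro n
  rw [mul_sub, mul_one, map_sub]
  cases n with
  | zero => simpa using coeffNonneg_partGF 0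
  | succ n =>
    rw [coeff_succ_mul_X, partGF, coeff_mk, coeff_mk, sub_nonneg]
    exact_mod_cast card_partition_le_succ n

/-- `∏ (1 - q^j)^{-24}`. -/
noncomputable def etaGF : ℝ⟦X⟧ := partGF ^ 24

lemma coeffNonneg_etaGF : CoeffNonneg etaGF := coeffNonneg_partGF.pow 24

lemma etaGF_eq : etaGF = (partGF * (1 - X)) ^ 24 * geom ^ 24 := by
  rw [← mul_pow, mul_assoc, mul_comm (1 - X), geom_mul_one_sub, mul_one, etaGF]

lemma coeffNonneg_etaGF_mul_one_sub_sq : CoeffNonneg (etaGF * (1 - X) ^ 2) := by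
  have : etaGF * (1 - X) ^ 2 = (partGF * (1 - X)) ^ 24 * geom ^ 22 * (geom * (1 - X)) ^ 2 := by
    rw [etaGF_eq]; ring
  rw [this, geom_mul_one_sub, one_pow, mul_one]
  exact (coeffNonneg_partGF_mul_one_sub.pow _).mul (coeffNonneg_geom.pow _)

lemma coeffNonneg_etaGF_mul_one_sub : CoeffNonneg (etaGF * (1 - X)) := by
  have : etaGF * (1 - X) = etaGF * (1 - X) ^ 2 * geom := by
    linear_combination -(etaGF * (1 - X)) * geom_mul_one_sub
  rw [this]
  exact coeffNonneg_etaGF_mul_one_sub_sq.mul coeffNonneg_geom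

/-- A Cauchy-Schwarz inequality between the coefficients, their sums and their double sums. -/
lemma sq_coeff_etaGF_mul_geom_le (n : ℕ) :
    24 * coeff n (etaGF * geom) ^ 2 ≤ 25 * (coeff n etaGF * coeff n (etaGF * geom ^ 2)) := by
  set c : ℕ → ℝ := fun i ↦ coeff i ((partGF * (1 - X)) ^ 24) with hc
  have hc0 : ∀ i, 0 ≤ c i := coeffNonneg_partGF_mul_one_sub.pow 24
  have hrep (e : ℕ) : coeff n (etaGF * geom ^ e) =
      ∑ x ∈ antidiagonal n, c x.1 * ((23 + e + x.2).choose (23 + e) : ℝ) := by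
    rw [etaGF_eq, mul_assoc, ← pow_add, show 24 + e = 23 + e + 1 by ring, coeff_mul]
    simp only [coeff_geom_pow_succ, hc]
  have h0 := hrep 0
  have h1 := hrep 1
  have h2 := hrep 2
  rw [pow_zero, mul_one] at h0
  rw [pow_one] at h1
  rw [h0, h1, h2]
  have r1 (M : ℕ) : ((23 + 1 + M).choose (23 + 1) : ℝ) * 24 =
      (23 + 0 + M).choose (23 + 0) * (M + 24) := by
    have := Nat.add_one_mul_choose_eq (23 + M) 23
    rw [show 23 + 1 + M = 23 + M + 1 by ring]
    push_cast [← @Nat.cast_inj ℝ] at this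
    norm_num at this ⊢
    linarith
  have r2 (M : ℕ) : ((23 + 2 + M).choose (23 + 2) : ℝ) * 25 =
      (23 + 1 + M).choose (23 + 1) * (M + 25) := by
    have := Nat.add_one_mul_choose_eq (24 + M) 24
    rw [show 23 + 2 + M = 24 + M + 1 by ring]
    push_cast [← @Nat.cast_inj ℝ] at this
    norm_num at this ⊢
    linarith
  have cs := Finset.sum_sq_le_sum_mul_sum_of_sq_le_mul (antidiagonal n)
    (r := fun x ↦ c x.1 * ((23 + 1 + x.2).choose (23 + 1) : ℝ))
    (f := fun x ↦ c x.1 * ((23 + 0 + x.2).choose (23 + 0) : ℝ))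
    (g := fun x ↦ c x.1 * (((23 + 1 + x.2).choose (23 + 1) : ℝ) * ((x.2 + 24) / 24)))
    (fun x _ ↦ mul_nonneg (hc0 _) (by positivity))
    (fun x _ ↦ mul_nonneg (hc0 _) (by positivity))
    (fun x _ ↦ le_of_eq <| by
      linear_combination c x.1 ^ 2 * ((23 + 1 + x.2).choose (23 + 1) : ℝ) / 24 * r1 x.2)
  have hg : 24 * ∑ x ∈ antidiagonal n,
      c x.1 * (((23 + 1 + x.2).choose (23 + 1) : ℝ) * ((x.2 + 24) / 24)) ≤
      25 * ∑ x ∈ antidiagonal n, c x.1 * ((23 + 2 + x.2).choose (23 + 2) : ℝ) := by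
    rw [Finset.mul_sum, Finset.mul_sum]
    refine Finset.sum_le_sum fun x _ ↦ ?_
    have h : (0 : ℝ) ≤ (23 + 1 + x.2).choose (23 + 1) := Nat.cast_nonneg _
    have := mul_nonneg (hc0 x.1) h
    linear_combination this - c x.1 * r2 x.2
  have hpos : 0 ≤ ∑ x ∈ antidiagonal n, c x.1 * ((23 + 0 + x.2).choose (23 + 0) : ℝ) :=
    Finset.sum_nonneg fun x _ ↦ mul_nonneg (hc0 _) (Nat.cast_nonneg _)
  have := mul_le_mul_of_nonneg_left hg hpos
  linarith

lemma coeff_mul_le_coeff_mul {f g h : ℝ⟦X⟧} (hf : CoeffNonneg f)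
    (hgh : ∀ n, coeff n g ≤ coeff n h) (n : ℕ) : coeff n (f * g) ≤ coeff n (f * h) := by
  rw [coeff_mul, coeff_mul]
  exact Finset.sum_le_sum fun x _ ↦ mul_le_mul_of_nonneg_left (hgh _) (hf _)

lemma coeff_X_mul_derivative (f : ℝ⟦X⟧) (n : ℕ) : coeff n (X * d⁄dX ℝ f) = n * coeff n f := by
  cases n with
  | zero => simp
  | succ n =>
    rw [coeff_succ_X_mul, coeff_derivative]
    push_cast
    ring

lemma coeff_partGF_mul_divisorWeight_le (n : ℕ) :
    coeff n (partGF * mk fun j ↦ (divisorWeight j : ℝ)) ≤ coeff n (X * d⁄dX ℝ partGF) := by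
  rw [coeff_X_mul_derivative, mul_comm, coeff_mul,
    Finset.Nat.sum_antidiagonal_eq_sum_range_succ_mk]
  simp only [partGF, coeff_mk]
  exact_mod_cast sum_range_divisorWeight_mul_card_partition_le n

lemma coeff_etaGF_mul_divisorWeight_le (n : ℕ) :
    24 * coeff n (etaGF * mk fun j ↦ (divisorWeight j : ℝ)) ≤ n * coeff n etaGF := by
  have hd : X * d⁄dX ℝ etaGF = C (24 : ℝ) * (partGF ^ 23 * (X * d⁄dX ℝ partGF)) := by
    rw [etaGF, Derivation.leibniz_pow]
    simp only [smul_eq_mul, nsmul_eq_mul]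
    rw [show (C (24 : ℝ) : ℝ⟦X⟧) = 24 from map_ofNat _ 24]
    push_cast
    ring
  rw [← coeff_X_mul_derivative, hd, coeff_C_mul, etaGF, pow_succ, mul_assoc]
  exact mul_le_mul_of_nonneg_left (coeff_mul_le_coeff_mul (coeffNonneg_partGF.pow 23)
    coeff_partGF_mul_divisorWeight_le n) (by norm_num)

lemma coeff_etaGF_mul_geom_sq_le (n : ℕ) :
    30 * coeff n (etaGF * geom ^ 2) ≤ n * coeff n etaGF + 36 * coeff n (etaGF * geom) := by
  set V : ℝ⟦X⟧ := mk fun j ↦ if Even j then (j : ℝ) / 2 else 0 with hV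
  have hV0 : CoeffNonneg V := .mk fun j ↦ by split_ifs <;> positivity
  have hcoeff (j : ℕ) : coeff j (geom ^ 2) = (j : ℝ) + 1 := by
    rw [show geom ^ 2 = geom ^ (1 + 1) from rfl, coeff_geom_pow_succ, Nat.choose_one_right]
    push_cast
    ring
  have hgeom (j : ℕ) : coeff j geom = 1 := by rw [geom, coeff_mk]; rfl
  have hW : (mk fun j ↦ (divisorWeight j : ℝ)) = geom ^ 2 - geom + V := by
    ext j
    rw [map_add, map_sub, hcoeff, hgeom, hV, coeff_mk, coeff_mk, divisorWeight]
    rcases Nat.even_or_odd j with h | h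
    · rw [if_pos h, if_pos h, Nat.cast_add, Nat.cast_div h.two_dvd two_ne_zero]
      push_cast
      ring
    · rw [if_neg (Nat.not_even_iff_odd.2 h), if_neg (Nat.not_even_iff_odd.2 h)]
      push_cast
      ring
  have hVpair (j : ℕ) : coeff j (C (1 / 2 : ℝ) * geom ^ 2 - geom) ≤ coeff j (V * (1 + X)) := by
    rw [map_sub, coeff_C_mul, hcoeff, hgeom, mul_add V, mul_one, map_add]
    cases j with
    | zero => simp [hV]; norm_num
    | succ j =>
      rw [coeff_succ_mul_X, hV, coeff_mk, coeff_mk]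
      rcases Nat.even_or_odd j with h | h
      · rw [if_neg (Nat.not_even_iff_odd.2 h.add_one), if_pos h]
        push_cast
        linarith
      · rw [if_pos h.add_one, if_neg (Nat.not_even_iff_odd.2 h)]
        push_cast
        linarith
  have h1 := coeff_mul_le_coeff_mul coeffNonneg_etaGF hVpair n
  have h2 := (coeffNonneg_etaGF_mul_one_sub.mul hV0) n
  have h3 : coeff n (etaGF * (V * (1 + X))) + coeff n (etaGF * (1 - X) * V) =
      2 * coeff n (etaGF * V) := by
    rw [← map_add, two_mul, ← map_add]
    congr 1
    ring
  have h4 : coeff n (etaGF * (C (1 / 2 : ℝ) * geom ^ 2 - geom)) =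
      1 / 2 * coeff n (etaGF * geom ^ 2) - coeff n (etaGF * geom) := by
    rw [← coeff_C_mul, ← map_sub]
    congr 1
    ring
  have h5 := coeff_etaGF_mul_divisorWeight_le n
  rw [h4] at h1
  rw [hW, mul_add, mul_sub, map_add, map_sub] at h5
  linarith

lemma coeff_etaGF_mul_geom_le (n : ℕ) :
    coeff n (etaGF * geom) ≤ (5 + 13 / (22 * Real.pi) * Real.sqrt n) * coeff n etaGF := by
  set a := coeff n etaGF
  set T := coeff n (etaGF * geom)
  have ha : 0 ≤ a := coeffNonneg_etaGF n
  have hT : 144 * T ^ 2 ≤ 5 * (a * (n * a + 36 * T)) := by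
    have h1 := sq_coeff_etaGF_mul_geom_le n
    have h2 := mul_le_mul_of_nonneg_left (coeff_etaGF_mul_geom_sq_le n) ha
    linarith
  clear_value a T
  set s := 13 / (22 * Real.pi) * Real.sqrt n with hs
  have hs0 : 0 ≤ s := by positivity
  have hsn : 5 * (n : ℝ) ≤ 144 * s ^ 2 := by
    have hpi : 13 / (22 * 3.1416) ≤ 13 / (22 * Real.pi) := by
      have := Real.pi_lt_d4
      gcongr
    have hsq : (13 / (22 * 3.1416)) ^ 2 ≤ (13 / (22 * Real.pi)) ^ 2 := by gcongr
    rw [hs, mul_pow, Real.sq_sqrt (Nat.cast_nonneg n)]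
    have := mul_le_mul_of_nonneg_right hsq (Nat.cast_nonneg (α := ℝ) n)
    have hn : (0 : ℝ) ≤ n := Nat.cast_nonneg n
    norm_num at this ⊢
    linarith
  clear_value s
  by_contra! hlt
  have h6 : 5 * (n : ℝ) * a ^ 2 ≤ 144 * s ^ 2 * a ^ 2 :=
    mul_le_mul_of_nonneg_right hsn (sq_nonneg a)
  have hsa : 0 ≤ s * a := mul_nonneg hs0 ha
  have h7 : s * a * (s * a) < (T - 5 / 4 * a) * T :=
    mul_lt_mul'' (by linarith) (by linarith) hsa hsa
  linarith

lemma sum_antidiagonalTuple_prod_eq_coeff_pow (f : ℕ → ℝ) (k n : ℕ) :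
    ∑ v ∈ Finset.Nat.antidiagonalTuple k n, ∏ i, f (v i) = coeff n (mk f ^ k) := by
  have h : (mk f) ^ k = ∏ _i : Fin k, mk f := by simp
  rw [h, coeff_prod]
  symm
  refine Finset.sum_bij (fun l _ ↦ (l : Fin k → ℕ)) ?_ ?_ ?_ ?_
  · intro l hl
    rw [Finset.Nat.mem_antidiagonalTuple]
    exact (mem_finsuppAntidiag.1 hl).1
  · intro l _ l' _ hll
    exact DFunLike.coe_injective hll
  · intro v hv
    refine ⟨Finsupp.equivFunOnFinite.symm v, ?_, rfl⟩
    rw [mem_finsuppAntidiag]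
    exact ⟨Finset.Nat.mem_antidiagonalTuple.1 hv, Finset.subset_univ _⟩
  · intro l _
    simp

/-- The coefficients of a power series indexed by `ℤ`, with the shift used in `dcoef`. -/
noncomputable def shiftedCoeff (f : ℝ⟦X⟧) (x : ℤ) : ℝ :=
  if 0 ≤ x + 1 then coeff (x + 1).toNat f else 0

lemma shiftedCoeff_of_lt (f : ℝ⟦X⟧) {x : ℤ} (hx : x < -1) : shiftedCoeff f x = 0 :=
  if_neg (by omega)

lemma shiftedCoeff_natCast_sub_one (f : ℝ⟦X⟧) (n : ℕ) : shiftedCoeff f (n - 1) = coeff n f := by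
  rw [shiftedCoeff, if_pos (by omega)]
  congr
  omega

lemma shiftedCoeff_nonneg {f : ℝ⟦X⟧} (hf : CoeffNonneg f) (x : ℤ) : 0 ≤ shiftedCoeff f x := by
  rw [shiftedCoeff]
  split_ifs
  · exact hf _
  · exact le_rfl

lemma shiftedCoeff_mul_one_sub (f : ℝ⟦X⟧) (x : ℤ) :
    shiftedCoeff (f * (1 - X)) x = shiftedCoeff f x - shiftedCoeff f (x - 1) := by
  rcases lt_or_ge x (-1) with hx | hx
  · rw [shiftedCoeff_of_lt _ hx, shiftedCoeff_of_lt _ hx, shiftedCoeff_of_lt _ (by omega), sub_zero]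
  · obtain ⟨n, rfl⟩ : ∃ n : ℕ, x = n - 1 := ⟨(x + 1).toNat, by omega⟩
    rw [shiftedCoeff_natCast_sub_one, shiftedCoeff_natCast_sub_one, mul_sub, mul_one, map_sub]
    cases n with
    | zero => rw [shiftedCoeff_of_lt _ (by norm_num)]; simp
    | succ n =>
      rw [coeff_succ_mul_X, ← shiftedCoeff_natCast_sub_one f n]
      congr 2
      push_cast
      ring

lemma dcoef_eq (x : ℤ) : (dcoef x : ℝ) = shiftedCoeff etaGF x := by
  rw [dcoef, shiftedCoeff, etaGF, partGF, ← sum_antidiagonalTuple_prod_eq_coeff_pow]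
  split_ifs <;> simp

lemma dcoef_nonneg (x : ℤ) : 0 ≤ (dcoef x : ℝ) := by
  rw [dcoef_eq]
  exact shiftedCoeff_nonneg coeffNonneg_etaGF x

lemma dcoef_of_lt {x : ℤ} (hx : x < -1) : dcoef x = 0 := if_neg (by omega)

lemma monotone_dcoef : Monotone fun x ↦ (dcoef x : ℝ) := by
  refine monotone_int_of_le_succ fun x ↦ ?_
  have := shiftedCoeff_nonneg coeffNonneg_etaGF_mul_one_sub (x + 1)
  rw [shiftedCoeff_mul_one_sub, add_sub_cancel_right] at this
  rw [dcoef_eq, dcoef_eq]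
  linarith

lemma monotone_dcoef_sub : Monotone fun x ↦ (dcoef x - dcoef (x - 1) : ℝ) := by
  refine monotone_int_of_le_succ fun x ↦ ?_
  have := shiftedCoeff_nonneg coeffNonneg_etaGF_mul_one_sub_sq (x + 1)
  rw [pow_two, ← mul_assoc, shiftedCoeff_mul_one_sub, shiftedCoeff_mul_one_sub,
    shiftedCoeff_mul_one_sub, add_sub_cancel_right] at this
  simp only [dcoef_eq, add_sub_cancel_right]
  linarith

lemma two_mul_dcoef_le (x : ℤ) (s : ℕ) : 2 * (dcoef x : ℝ) ≤ dcoef (x + s) + dcoef (x - s) := by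
  induction s with
  | zero => simp [two_mul]
  | succ s ih =>
    have := monotone_dcoef_sub (show x - s ≤ x + s + 1 by omega)
    simp only [add_sub_cancel_right] at this
    rw [sub_sub] at this
    push_cast
    rw [← add_assoc]
    linarith

/-- The partial sums of `dcoef`. -/
noncomputable def dcoefSum (x : ℤ) : ℝ := shiftedCoeff (etaGF * geom) x

lemma dcoefSum_sub (x : ℤ) : dcoefSum x - dcoefSum (x - 1) = dcoef x := by
  rw [dcoefSum, dcoefSum, ← shiftedCoeff_mul_one_sub, mul_assoc, geom_mul_one_sub, mul_one,
    dcoef_eq]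

lemma dcoefSum_nonneg (x : ℤ) : 0 ≤ dcoefSum x :=
  shiftedCoeff_nonneg (coeffNonneg_etaGF.mul coeffNonneg_geom) x

lemma two_mul_mul_dcoef_le (x : ℤ) (r : ℕ) :
    2 * (r * (dcoef x : ℝ)) ≤ dcoefSum (x + r) - dcoefSum (x - r) := by
  induction r with
  | zero => simp
  | succ r ih =>
    have h1 := dcoefSum_sub (x + r + 1)
    have h2 := dcoefSum_sub (x - r)
    have h3 := two_mul_dcoef_le x r
    have h4 := monotone_dcoef (show x + r ≤ x + r + 1 by omega)
    simp only [add_sub_cancel_right] at h1 h4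
    push_cast
    rw [← add_assoc, ← sub_sub]
    linarith

lemma sum_mul_dcoef_le (k : ℤ) (R : ℕ) :
    2 * ∑ r ∈ range R, ((r + 1 : ℕ) : ℝ) * dcoef (k - ((r + 1 : ℕ) : ℤ) ^ 2) ≤
      dcoef (k - 1) + dcoefSum (k - 1) := by
  have key (R : ℕ) :
      2 * ∑ r ∈ range (R + 1), ((r + 1 : ℕ) : ℝ) * dcoef (k - ((r + 1 : ℕ) : ℤ) ^ 2) ≤
        dcoef (k - 1) + dcoefSum (k - 1) - dcoefSum (k - (R + 1) * (R + 2)) := by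
    induction R with
    | zero =>
      have := dcoefSum_sub (k - 1)
      norm_num [sub_sub] at this ⊢
      linarith
    | succ R ih =>
      rw [Finset.sum_range_succ, mul_add]
      have h := two_mul_mul_dcoef_le (k - ((R + 1 + 1 : ℕ) : ℤ) ^ 2) (R + 1 + 1)
      rw [show k - ((R + 1 + 1 : ℕ) : ℤ) ^ 2 + ((R + 1 + 1 : ℕ) : ℤ) = k - (R + 1) * (R + 2) by
          push_cast; ring,
        show k - ((R + 1 + 1 : ℕ) : ℤ) ^ 2 - ((R + 1 + 1 : ℕ) : ℤ) =
          k - (((R + 1 : ℕ) : ℤ) + 1) * (((R + 1 : ℕ) : ℤ) + 2) by push_cast; ring] at h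
      linarith
  cases R with
  | zero =>
    have h1 := dcoef_nonneg (k - 1)
    have h2 := dcoefSum_nonneg (k - 1)
    simp only [range_zero, Finset.sum_empty]
    linarith
  | succ R =>
    have := dcoefSum_nonneg (k - (R + 1) * (R + 2))
    linarith [key R]

lemma cFm1_eq_sum {k l : ℤ} (hl : 0 ≤ l) (R : ℕ) (hR : k < R) :
    cFm1 (k + l) l = ∑ r ∈ range R, (2 * ((r + 1 : ℕ) : ℤ) + l) *
      dcoef (k + l - ((r + 1 : ℕ) : ℤ) ^ 2 - ((r + 1 : ℕ) : ℤ) * l) := by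
  have hinj : Set.InjOn (fun r : ℕ ↦ ((r + 1 : ℕ) : ℤ)) (range R) := by
    intro a _ b _ hab
    simp only at hab
    omega
  rw [cFm1, finsum_eq_sum_of_support_subset (s := (range R).image fun r : ℕ ↦ ((r + 1 : ℕ) : ℤ)),
    Finset.sum_image hinj]
  · exact Finset.sum_congr rfl fun r _ ↦ if_pos (by omega)
  · intro r hr
    rw [Function.mem_support] at hr
    have h1 : 1 ≤ r := by
      by_contra h
      exact hr (if_neg h)
    rw [if_pos h1] at hr
    have h2 : -1 ≤ k + l - r ^ 2 - r * l := by
      by_contra! h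
      exact hr (by rw [dcoef_of_lt h, mul_zero])
    have h3 : r ≤ R := by
      by_contra! h
      nlinarith
    simp only [coe_image, Set.mem_image, coe_range, Set.mem_Iio]
    exact ⟨(r - 1).toNat, by omega, by omega⟩

theorem stmt11 (m k : ℤ) (hm : 6 ≤ m) (hk5 : 5 ≤ k) (hkm : k ≤ m) :
    (cFm1 m (m - k) : ℝ) ≤
      (3 + 2 / 100000 + (13 / (44 * Real.pi)) * Real.sqrt k) *
        ((((m - k) + 2) * dcoef (k - 1) : ℤ) : ℝ) := by
  obtain ⟨l, rfl⟩ : ∃ l, m = k + l := ⟨m - k, by ring⟩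
  lift k to ℕ using by omega
  have hl : 0 ≤ l := by omega
  have hlR : (0 : ℝ) ≤ l := by exact_mod_cast hl
  rw [add_sub_cancel_left, cFm1_eq_sum hl (k + 1) (by push_cast; omega)]
  have hterm : ∀ r ∈ range (k + 1), (((2 * ((r + 1 : ℕ) : ℤ) + l) *
      dcoef (k + l - ((r + 1 : ℕ) : ℤ) ^ 2 - ((r + 1 : ℕ) : ℤ) * l) : ℤ) : ℝ) ≤
      (l + 2) * (((r + 1 : ℕ) : ℝ) * dcoef (k - ((r + 1 : ℕ) : ℤ) ^ 2)) := by
    intro r _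
    have hmono := monotone_dcoef (show (k : ℤ) + l - ((r + 1 : ℕ) : ℤ) ^ 2 -
      ((r + 1 : ℕ) : ℤ) * l ≤ k - ((r + 1 : ℕ) : ℤ) ^ 2 by push_cast; nlinarith)
    rw [Int.cast_mul, ← mul_assoc]
    refine mul_le_mul ?_ hmono (dcoef_nonneg _) (by positivity)
    push_cast
    nlinarith [mul_nonneg (Nat.cast_nonneg (α := ℝ) r) hlR]
  have hsum := sum_mul_dcoef_le k (k + 1)
  have hT := coeff_etaGF_mul_geom_le k
  rw [← shiftedCoeff_natCast_sub_one, ← shiftedCoeff_natCast_sub_one, ← dcoef_eq] at hT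
  change dcoefSum _ ≤ _ at hT
  have hd := dcoef_nonneg (k - 1)
  have hpi : 13 / (22 * Real.pi) = 2 * (13 / (44 * Real.pi)) := by ring
  rw [hpi] at hT
  rw [Int.cast_sum]
  refine (Finset.sum_le_sum hterm).trans ?_
  rw [← Finset.mul_sum]
  have hfin : ∑ r ∈ range (k + 1), ((r + 1 : ℕ) : ℝ) * dcoef (k - ((r + 1 : ℕ) : ℤ) ^ 2) ≤
      (3 + 2 / 100000 + 13 / (44 * Real.pi) * Real.sqrt k) * dcoef (k - 1) := by
    linarith
  have := mul_le_mul_of_nonneg_left hfin (by positivity : (0 : ℝ) ≤ l + 2)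
  push_cast at this ⊢
  linarith
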